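/- Fix real σ, ρ, t with σ ≠ 0, t > 0, and u ∈ ℂ with u ≠ 0. For κ ∈ ℝ define ξ(κ) := κ − σρiu, d(κ) := (ξ(κ)² + σ²(u²+iu))^{1/2} (principal square root), A₂(κ) := d(κ)·cosh(d(κ)t/2) + ξ(κ)·sinh(d(κ)t/2), and B(κ) := d(κ)·e^{κt/2}/A₂(κ). Suppose at κ₀ the radicand ξ(κ₀)² + σ²(u²+iu) does not lie in (−∞, 0] and A₂(κ₀) ≠ 0. Then κ ↦ B(κ) is differentiable at κ₀ with derivative ∂B/∂κ = (i/(σu))·Bρ' + t·B(κ₀)/2, where Bρ' := e^{κ₀ t/2}·( (1/A₂)·dρ' − (d/A₂²)·A₂ρ' ) with dρ' := −ξσiu/d and A₂ρ' := −σiu(2+tξ)(ξ cosh(dt/2)+d sinh(dt/2))/(2d) evaluated at κ₀; i.e. ∂B/∂κ = (i/(σu))·∂B/∂ρ + tB/2. -/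

import Mathlib

noncomputable section

/-- Principal complex square root `z^{1/2} := exp((1/2)·Log z)`. -/
def csqrt (z : ℂ) : ℂ := Complex.exp ((1 / 2 : ℂ) * Complex.log z)

/-- `ξ(κ) := κ − σρiu`. -/
def ξf (σ ρ : ℝ) (u : ℂ) (κ : ℝ) : ℂ := (κ : ℂ) - (σ : ℂ) * (ρ : ℂ) * Complex.I * u

/-- `d(κ) := (ξ(κ)² + σ²(u²+iu))^{1/2}` (principal square root). -/
def df (σ ρ : ℝ) (u : ℂ) (κ : ℝ) : ℂ :=
  csqrt ((ξf σ ρ u κ) ^ 2 + (σ : ℂ) ^ 2 * (u ^ 2 + Complex.I * u))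

/-- `A₂(κ) := d(κ)·cosh(d(κ)t/2) + ξ(κ)·sinh(d(κ)t/2)`. -/
def A₂f (σ ρ t : ℝ) (u : ℂ) (κ : ℝ) : ℂ :=
  df σ ρ u κ * Complex.cosh (df σ ρ u κ * (t : ℂ) / 2) +
    ξf σ ρ u κ * Complex.sinh (df σ ρ u κ * (t : ℂ) / 2)

/-- `B(κ) := d(κ)·e^{κt/2}/A₂(κ)`. -/
def Bf (σ ρ t : ℝ) (u : ℂ) (κ : ℝ) : ℂ :=
  df σ ρ u κ * Complex.exp ((κ : ℂ) * (t : ℂ) / 2) / A₂f σ ρ t u κ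

theorem csqrt_ne_zero (z : ℂ) : csqrt z ≠ 0 := Complex.exp_ne_zero _

theorem csqrt_sq {z : ℂ} (hz : z ≠ 0) : csqrt z ^ 2 = z := by
  rw [csqrt, ← Complex.exp_nat_mul]
  convert Complex.exp_log hz using 2
  push_cast
  ring

theorem hasDerivAt_csqrt {z : ℂ} (hz : z ∈ Complex.slitPlane) :
    HasDerivAt csqrt (1 / (2 * csqrt z)) z := by
  have h : HasDerivAt csqrt (csqrt z * ((1 / 2 : ℂ) * z⁻¹)) z :=
    ((Complex.hasDerivAt_log hz).const_mul (1 / 2 : ℂ)).cexp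
  convert h using 1
  have hz0 := Complex.slitPlane_ne_zero hz
  have hs := csqrt_ne_zero z
  field_simp
  exact (csqrt_sq hz0).symm

theorem hasDerivAt_ξf (σ ρ : ℝ) (u : ℂ) (κ : ℝ) : HasDerivAt (ξf σ ρ u) 1 κ :=
  Complex.ofRealCLM.hasDerivAt.sub_const _

theorem df_ne_zero (σ ρ : ℝ) (u : ℂ) (κ : ℝ) : df σ ρ u κ ≠ 0 := csqrt_ne_zero _

theorem hasDerivAt_df {σ ρ : ℝ} {u : ℂ} {κ : ℝ}
    (hw : (ξf σ ρ u κ) ^ 2 + (σ : ℂ) ^ 2 * (u ^ 2 + Complex.I * u) ∈ Complex.slitPlane) :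
    HasDerivAt (df σ ρ u) (ξf σ ρ u κ / df σ ρ u κ) κ := by
  have h := (hasDerivAt_csqrt hw).comp κ (((hasDerivAt_ξf σ ρ u κ).pow 2).add_const
    ((σ : ℂ) ^ 2 * (u ^ 2 + Complex.I * u)))
  refine h.congr_deriv ?_
  change 1 / (2 * df σ ρ u κ) * _ = _
  have hd := df_ne_zero σ ρ u κ
  field_simp
  norm_num

theorem hasDerivAt_A₂f {σ ρ : ℝ} (t : ℝ) {u : ℂ} {κ : ℝ}
    (hw : (ξf σ ρ u κ) ^ 2 + (σ : ℂ) ^ 2 * (u ^ 2 + Complex.I * u) ∈ Complex.slitPlane) :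
    HasDerivAt (A₂f σ ρ t u)
      ((2 + (t : ℂ) * ξf σ ρ u κ) * (ξf σ ρ u κ * Complex.cosh (df σ ρ u κ * (t : ℂ) / 2) +
        df σ ρ u κ * Complex.sinh (df σ ρ u κ * (t : ℂ) / 2)) / (2 * df σ ρ u κ)) κ := by
  have hd := hasDerivAt_df hw
  have harg := (hd.mul_const (t : ℂ)).div_const 2
  have hcosh := (Complex.hasDerivAt_cosh _).comp κ harg
  have hsinh := (Complex.hasDerivAt_sinh _).comp κ harg
  refine ((hd.mul hcosh).add ((hasDerivAt_ξf σ ρ u κ).mul hsinh)).congr_deriv ?_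
  have hd0 := df_ne_zero σ ρ u κ
  simp only [Function.comp_apply]
  field_simp
  ring


/-- `∂B/∂κ = (i/(σu))·∂B/∂ρ + tB/2`, with the explicit ρ-partial derivatives
`dρ' = −ξσiu/d` and `A₂ρ'` of `d` and `A₂`. -/
theorem hasDerivAt_B_kappa (σ ρ t : ℝ) (hσ : σ ≠ 0) (ht : 0 < t) (u : ℂ) (hu : u ≠ 0)
    (κ₀ : ℝ)
    (hw : (ξf σ ρ u κ₀) ^ 2 + (σ : ℂ) ^ 2 * (u ^ 2 + Complex.I * u) ∈ Complex.slitPlane)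
    (hA₂0 : A₂f σ ρ t u κ₀ ≠ 0) (dρ' A₂ρ' Bρ' : ℂ)
    (hdρ' : dρ' = -(ξf σ ρ u κ₀) * (σ : ℂ) * Complex.I * u / df σ ρ u κ₀)
    (hA₂ρ' : A₂ρ' = -((σ : ℂ) * Complex.I * u * (2 + (t : ℂ) * ξf σ ρ u κ₀)) *
      (ξf σ ρ u κ₀ * Complex.cosh (df σ ρ u κ₀ * (t : ℂ) / 2) +
        df σ ρ u κ₀ * Complex.sinh (df σ ρ u κ₀ * (t : ℂ) / 2)) / (2 * df σ ρ u κ₀))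
    (hBρ' : Bρ' = Complex.exp ((κ₀ : ℂ) * (t : ℂ) / 2) *
      ((1 / A₂f σ ρ t u κ₀) * dρ' - (df σ ρ u κ₀ / (A₂f σ ρ t u κ₀) ^ 2) * A₂ρ')) :
    HasDerivAt (Bf σ ρ t u)
      ((Complex.I / ((σ : ℂ) * u)) * Bρ' + (t : ℂ) * Bf σ ρ t u κ₀ / 2) κ₀ := by
  have hd0 := df_ne_zero σ ρ u κ₀
  have hσ0 : (σ : ℂ) ≠ 0 := Complex.ofReal_ne_zero.mpr hσ
  have hexp : HasDerivAt (fun κ : ℝ => Complex.exp ((κ : ℂ) * (t : ℂ) / 2))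
      (Complex.exp ((κ₀ : ℂ) * (t : ℂ) / 2) * (1 * (t : ℂ) / 2)) κ₀ :=
    ((Complex.ofRealCLM.hasDerivAt.mul_const (t : ℂ)).div_const 2).cexp
  refine (((hasDerivAt_df hw).mul hexp).div (hasDerivAt_A₂f t hw) hA₂0).congr_deriv ?_
  have hcancel : Complex.I / ((σ : ℂ) * u) * ((σ : ℂ) * Complex.I * u) = -1 := by
    field_simp
    exact Complex.I_sq
  have hd_ρ : Complex.I / ((σ : ℂ) * u) * dρ' = ξf σ ρ u κ₀ / df σ ρ u κ₀ := by
    rw [hdρ']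
    linear_combination (-(ξf σ ρ u κ₀ / df σ ρ u κ₀)) * hcancel
  have hA_ρ : Complex.I / ((σ : ℂ) * u) * A₂ρ' = (2 + (t : ℂ) * ξf σ ρ u κ₀) *
      (ξf σ ρ u κ₀ * Complex.cosh (df σ ρ u κ₀ * (t : ℂ) / 2) +
        df σ ρ u κ₀ * Complex.sinh (df σ ρ u κ₀ * (t : ℂ) / 2)) / (2 * df σ ρ u κ₀) := by
    rw [hA₂ρ']
    linear_combination (-((2 + (t : ℂ) * ξf σ ρ u κ₀) *
      (ξf σ ρ u κ₀ * Complex.cosh (df σ ρ u κ₀ * (t : ℂ) / 2) +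
        df σ ρ u κ₀ * Complex.sinh (df σ ρ u κ₀ * (t : ℂ) / 2)) / (2 * df σ ρ u κ₀))) * hcancel
  rw [← hd_ρ, ← hA_ρ, hBρ', Bf]
  simp only [Pi.mul_apply]
  field_simp
  ring
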